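/- For every γ ∈ [0,∞)^d, the linear span of the Laguerre functions {𝓛_n^γ : n ∈ ℕ₀^d} is dense in S(ℝ^d₊): for every f ∈ S(ℝ^d₊), every j ∈ ℕ₀ and every ε > 0 there exists a finite linear combination g = ∑_{k ≤ n} a_k 𝓛_k^γ (with a_k ∈ ℂ) such that q_j(f − g) < ε. -/

import Mathlib

open MeasureTheory Filter Finset

noncomputable section

def Rpos (d : ℕ) : Set (Fin d → ℝ) := {x | ∀ i, 0 < x i}

def pd {d : ℕ} (i : Fin d) (f : (Fin d → ℝ) → ℂ) : (Fin d → ℝ) → ℂ :=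
  fun x => fderiv ℝ f x (Pi.single i 1)

def mderiv {d : ℕ} (p : Fin d → ℕ) (f : (Fin d → ℝ) → ℂ) : (Fin d → ℝ) → ℂ :=
  ((List.ofFn fun i : Fin d => (fun g => (pd i)^[p i] g)).foldr (· ∘ ·) id) f

/-- The space `S(ℝ^d₊)`. -/
def IsSPlus {d : ℕ} (f : (Fin d → ℝ) → ℂ) : Prop :=
  ContDiffOn ℝ (⊤ : ℕ∞) f (Rpos d) ∧
  (∀ p : Fin d → ℕ, ∃ g : (Fin d → ℝ) → ℂ,
    ContinuousOn g {x | ∀ i, 0 ≤ x i} ∧ ∀ x ∈ Rpos d, g x = mderiv p f x) ∧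
  (∀ k p : Fin d → ℕ, ∃ C : ℝ, ∀ x ∈ Rpos d,
    (∏ i, x i ^ k i) * ‖mderiv p f x‖ ≤ C)

/-- Laguerre polynomial of order `γ`. -/
def lagP (γ : ℝ) (j : ℕ) (t : ℝ) : ℝ :=
  ∑ k ∈ Finset.range (j+1),
    Real.Gamma (j + γ + 1) / (Real.Gamma (k + γ + 1) * (j-k).factorial * (k.factorial)) * (-t)^k

/-- Laguerre function of order `γ`. -/
def lagFun (γ : ℝ) (j : ℕ) (t : ℝ) : ℝ :=
  Real.sqrt (j.factorial / Real.Gamma (j + γ + 1)) * lagP γ j t * Real.exp (-t/2)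

/-- `d`-dimensional Laguerre function of order `γ ∈ [0,∞)^d`. -/
def LagFun {d : ℕ} (γ : Fin d → ℝ) (n : Fin d → ℕ) (t : Fin d → ℝ) : ℝ :=
  ∏ l, lagFun (γ l) (n l) (t l)

/-- The weight `∏ (1 + x i)`. -/
def orthantWeight {d : ℕ} (x : Fin d → ℝ) : ℝ := ∏ i, (1 + x i)

/-- The function `x ↦ P(x) e^{-(x₁ + ⋯ + x_d)/2}`. -/
def polyExp {d : ℕ} (P : MvPolynomial (Fin d) ℂ) (x : Fin d → ℝ) : ℂ :=
  MvPolynomial.eval (fun i => (x i : ℂ)) P * (Real.exp (-(∑ i, x i) / 2) : ℂ)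

/-- `u` is a limit of functions `polyExp P` for all polynomially weighted sup norms. -/
def IsPolyExpLimit {d : ℕ} (u : (Fin d → ℝ) → ℂ) : Prop :=
  ∀ M : ℕ, ∀ ε > 0, ∃ P : MvPolynomial (Fin d) ℂ, ∀ x : Fin d → ℝ, (∀ i, 0 ≤ x i) →
    orthantWeight x ^ M * ‖u x - polyExp P x‖ ≤ ε

section Weight

variable {d : ℕ} {x : Fin d → ℝ}

lemma one_le_orthantWeight (hx : ∀ i, 0 ≤ x i) : 1 ≤ orthantWeight x :=
  Finset.one_le_prod fun i _ => by linarith [hx i]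

lemma le_orthantWeight (hx : ∀ i, 0 ≤ x i) (i : Fin d) : 1 + x i ≤ orthantWeight x := by
  unfold orthantWeight
  rw [← Finset.mul_prod_erase _ _ (Finset.mem_univ i)]
  refine le_mul_of_one_le_right (by linarith [hx i]) ?_
  exact Finset.one_le_prod fun i _ => by linarith [hx i]

lemma exists_norm_eval_le (P : MvPolynomial (Fin d) ℂ) :
    ∃ (C : ℝ) (K : ℕ), 0 ≤ C ∧ ∀ x : Fin d → ℝ, (∀ i, 0 ≤ x i) →
      ‖MvPolynomial.eval (fun i => (x i : ℂ)) P‖ ≤ C * orthantWeight x ^ K := by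
  induction P using MvPolynomial.induction_on with
  | C a => exact ⟨‖a‖, 0, norm_nonneg _, fun x hx => by simp⟩
  | add P Q hP hQ =>
    obtain ⟨C, K, hC, h⟩ := hP
    obtain ⟨C', K', hC', h'⟩ := hQ
    refine ⟨C + C', K + K', by positivity, fun x hx => ?_⟩
    have hw := one_le_orthantWeight hx
    rw [map_add, add_mul]
    refine (norm_add_le _ _).trans (add_le_add ((h x hx).trans ?_) ((h' x hx).trans ?_))
    · gcongr
      omega
    · gcongr
      omega
  | mul_X P i hP =>
    obtain ⟨C, K, hC, h⟩ := hP
    refine ⟨C, K + 1, hC, fun x hx => ?_⟩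
    have hw := one_le_orthantWeight hx
    rw [map_mul, norm_mul, pow_succ, ← mul_assoc]
    simp only [MvPolynomial.eval_X, Complex.norm_real, Real.norm_eq_abs, abs_of_nonneg (hx i)]
    gcongr
    · exact hx i
    · exact h x hx
    · linarith [le_orthantWeight hx i]

lemma exists_orthantWeight_pow_mul_exp_le (K : ℕ) {c : ℝ} (hc : 0 < c) :
    ∃ C : ℝ, 0 ≤ C ∧ ∀ x : Fin d → ℝ, (∀ i, 0 ≤ x i) →
      orthantWeight x ^ K * Real.exp (-c * ∑ i, x i) ≤ C := by
  have key (t : ℝ) (ht : 0 ≤ t) :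
      (1 + t) ^ K * Real.exp (-c * t) ≤ K.factorial / c ^ K * Real.exp c := by
    have h := Real.pow_div_factorial_le_exp (x := c * (1 + t)) (by positivity) K
    rw [div_le_iff₀ (by positivity), mul_pow, mul_add, Real.exp_add, mul_one] at h
    rw [neg_mul, Real.exp_neg, ← div_eq_mul_inv, div_le_iff₀ (Real.exp_pos _), div_mul_eq_mul_div,
      div_mul_eq_mul_div, le_div_iff₀ (by positivity)]
    linarith
  refine ⟨∏ _i : Fin d, (K.factorial / c ^ K * Real.exp c), by positivity, fun x hx => ?_⟩
  rw [Finset.mul_sum, Real.exp_sum, orthantWeight, ← Finset.prod_pow, ← Finset.prod_mul_distrib]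
  refine Finset.prod_le_prod (fun i _ => ?_) fun i _ => key _ (hx i)
  have := hx i
  positivity

lemma exists_orthantWeight_pow_mul_norm_polyExp_le (P : MvPolynomial (Fin d) ℂ) (M : ℕ) :
    ∃ C : ℝ, 0 ≤ C ∧ ∀ x : Fin d → ℝ, (∀ i, 0 ≤ x i) →
      orthantWeight x ^ M * (‖polyExp P x‖ * Real.exp ((∑ i, x i) / 4)) ≤ C := by
  obtain ⟨C, K, hC, h⟩ := exists_norm_eval_le P
  obtain ⟨C', hC', h'⟩ := exists_orthantWeight_pow_mul_exp_le (d := d) (M + K)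
    (c := 1 / 4) (by norm_num)
  refine ⟨C * C', by positivity, fun x hx => ?_⟩
  have hw := one_le_orthantWeight hx
  rw [polyExp, norm_mul, Complex.norm_real, Real.norm_of_nonneg (Real.exp_pos _).le, mul_assoc,
    ← Real.exp_add]
  calc _ ≤ orthantWeight x ^ M * (C * orthantWeight x ^ K *
        Real.exp (-(∑ i, x i) / 2 + (∑ i, x i) / 4)) := by gcongr; exact h x hx
    _ = C * (orthantWeight x ^ (M + K) * Real.exp (-(1 / 4) * ∑ i, x i)) := by
      rw [show -(∑ i, x i) / 2 + (∑ i, x i) / 4 = -(1 / 4) * ∑ i, x i by ring]; ring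
    _ ≤ C * C' := by gcongr; exact h' x hx

end Weight

namespace IsPolyExpLimit

variable {d : ℕ} {u v : (Fin d → ℝ) → ℂ}

lemma polyExp (P : MvPolynomial (Fin d) ℂ) : IsPolyExpLimit (polyExp P) := fun M ε hε =>
  ⟨P, fun x hx => by simpa using hε.le⟩

lemma of_approx (h : ∀ M : ℕ, ∀ ε > 0, ∃ v, IsPolyExpLimit v ∧ ∀ x : Fin d → ℝ, (∀ i, 0 ≤ x i) →
    orthantWeight x ^ M * ‖u x - v x‖ ≤ ε) : IsPolyExpLimit u := fun M ε hε => by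
  obtain ⟨v, hv, huv⟩ := h M (ε / 2) (half_pos hε)
  obtain ⟨P, hP⟩ := hv M (ε / 2) (half_pos hε)
  refine ⟨P, fun x hx => ?_⟩
  have hw := one_le_orthantWeight hx
  calc _ ≤ orthantWeight x ^ M * (‖u x - v x‖ + ‖v x - _root_.polyExp P x‖) := by
        gcongr; exact norm_sub_le_norm_sub_add_norm_sub _ _ _
    _ ≤ ε := by linarith [mul_add (orthantWeight x ^ M) ‖u x - v x‖ ‖v x - _root_.polyExp P x‖,
                  huv x hx, hP x hx]

lemma congr (hu : IsPolyExpLimit u) (h : ∀ x : Fin d → ℝ, (∀ i, 0 ≤ x i) → v x = u x) :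
    IsPolyExpLimit v :=
  of_approx fun M ε hε => ⟨u, hu, fun x hx => by simpa [h x hx] using hε.le⟩

lemma add (hu : IsPolyExpLimit u) (hv : IsPolyExpLimit v) :
    IsPolyExpLimit (fun x => u x + v x) := fun M ε hε => by
  obtain ⟨P, hP⟩ := hu M (ε / 2) (half_pos hε)
  obtain ⟨Q, hQ⟩ := hv M (ε / 2) (half_pos hε)
  refine ⟨P + Q, fun x hx => ?_⟩
  have hw := one_le_orthantWeight hx
  have : u x + v x - _root_.polyExp (P + Q) x
      = (u x - _root_.polyExp P x) + (v x - _root_.polyExp Q x) := by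
    simp only [_root_.polyExp, map_add]; ring
  rw [this]
  calc _ ≤ orthantWeight x ^ M * (‖u x - _root_.polyExp P x‖ + ‖v x - _root_.polyExp Q x‖) := by
        gcongr; exact norm_add_le _ _
    _ ≤ ε := by linarith [mul_add (orthantWeight x ^ M) ‖u x - _root_.polyExp P x‖
                  ‖v x - _root_.polyExp Q x‖, hP x hx, hQ x hx]

lemma const_mul (hu : IsPolyExpLimit u) (c : ℂ) : IsPolyExpLimit (fun x => c * u x) :=
  fun M ε hε => by
  obtain ⟨P, hP⟩ := hu M (ε / (‖c‖ + 1)) (by positivity)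
  refine ⟨MvPolynomial.C c * P, fun x hx => ?_⟩
  have hw := one_le_orthantWeight hx
  have : c * u x - _root_.polyExp (MvPolynomial.C c * P) x = c * (u x - _root_.polyExp P x) := by
    simp only [_root_.polyExp, map_mul, MvPolynomial.eval_C]; ring
  rw [this, norm_mul]
  have h := hP x hx
  rw [le_div_iff₀ (by positivity)] at h
  have : 0 ≤ orthantWeight x ^ M * ‖u x - _root_.polyExp P x‖ := by positivity
  nlinarith [norm_nonneg c]

lemma exists_bound (hu : IsPolyExpLimit u) (M : ℕ) : ∃ C : ℝ, 0 ≤ C ∧ ∀ x : Fin d → ℝ,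
    (∀ i, 0 ≤ x i) → orthantWeight x ^ M * ‖u x‖ ≤ C := by
  obtain ⟨P, hP⟩ := hu M 1 one_pos
  obtain ⟨C, hC, h⟩ := exists_orthantWeight_pow_mul_norm_polyExp_le P M
  refine ⟨1 + C, by positivity, fun x hx => ?_⟩
  have hw := one_le_orthantWeight hx
  have he : 1 ≤ Real.exp ((∑ i, x i) / 4) :=
    Real.one_le_exp (div_nonneg (Finset.sum_nonneg fun i _ => hx i) (by norm_num))
  calc _ ≤ orthantWeight x ^ M * (‖u x - _root_.polyExp P x‖ + ‖_root_.polyExp P x‖) := by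
        gcongr; simpa using norm_add_le (u x - _root_.polyExp P x) (_root_.polyExp P x)
    _ ≤ orthantWeight x ^ M * (‖u x - _root_.polyExp P x‖ +
          ‖_root_.polyExp P x‖ * Real.exp ((∑ i, x i) / 4)) := by
        gcongr; exact le_mul_of_one_le_right (norm_nonneg _) he
    _ ≤ 1 + C := by rw [mul_add]; exact add_le_add (hP x hx) (h x hx)

end IsPolyExpLimit

/-- The Taylor remainder of `exp` decays geometrically, at the cost of doubling the exponent. -/
lemma norm_exp_sub_sum_le_pow_mul_exp (z : ℂ) (n : ℕ) :
    ‖Complex.exp z - ∑ m ∈ range n, z ^ m / m.factorial‖ ≤ (1 / 2) ^ n * Real.exp (2 * ‖z‖) := by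
  refine (Complex.norm_exp_sub_sum_le_exp_norm_sub_sum z n).trans ?_
  have hs (r : ℝ) : HasSum (fun m : ℕ => r ^ (m + n) / (m + n).factorial)
      (Real.exp r - ∑ m ∈ range n, r ^ m / m.factorial) := by
    have := NormedSpace.expSeries_div_hasSum_exp r
    rw [← Real.exp_eq_exp_ℝ] at this
    exact (hasSum_nat_add_iff' (f := fun m : ℕ => r ^ m / m.factorial) n).2 this
  have h := hasSum_le (fun m => ?_) (hs ‖z‖) ((hs (2 * ‖z‖)).mul_left ((1 / 2) ^ n))
  · refine h.trans ?_
    gcongr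
    exact sub_le_self _ (Finset.sum_nonneg fun m _ => by positivity)
  · rw [mul_pow, pow_add 2, one_div, inv_pow]
    have : (1 : ℝ) ≤ 2 ^ m := one_le_pow₀ (by norm_num)
    rw [show ((2 : ℝ) ^ n)⁻¹ * (2 ^ m * 2 ^ n * ‖z‖ ^ (m + n) / (m + n).factorial)
      = 2 ^ m * (‖z‖ ^ (m + n) / (m + n).factorial) by field_simp]
    exact le_mul_of_one_le_left (by positivity) this

namespace IsPolyExpLimit

variable {d : ℕ} {u : (Fin d → ℝ) → ℂ}

lemma exp_mul_polyExp (P : MvPolynomial (Fin d) ℂ) (i : Fin d) :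
    IsPolyExpLimit (fun x => (Real.exp (-x i / 8) : ℂ) * _root_.polyExp P x) := fun M ε hε => by
  obtain ⟨C, hC, h⟩ := exists_orthantWeight_pow_mul_norm_polyExp_le P M
  obtain ⟨N, hN⟩ := exists_pow_lt_of_lt_one (show 0 < ε / (C + 1) by positivity)
    (show (1 / 2 : ℝ) < 1 by norm_num)
  refine ⟨(∑ m ∈ range N, MvPolynomial.C ((-1 / 8) ^ m / (m.factorial : ℂ)) *
    MvPolynomial.X i ^ m) * P, fun x hx => ?_⟩
  have hw := one_le_orthantWeight hx
  have e : (Real.exp (-x i / 8) : ℂ) * _root_.polyExp P x - _root_.polyExp ((∑ m ∈ range N,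
      MvPolynomial.C ((-1 / 8) ^ m / (m.factorial : ℂ)) * MvPolynomial.X i ^ m) * P) x
      = (Complex.exp (-x i / 8) - ∑ m ∈ range N, (-x i / 8 : ℂ) ^ m / m.factorial) *
        _root_.polyExp P x := by
    simp only [_root_.polyExp, map_mul, map_sum, map_pow, MvPolynomial.eval_C,
      MvPolynomial.eval_X]
    rw [show ∑ m ∈ range N, (-x i / 8 : ℂ) ^ m / m.factorial
      = ∑ m ∈ range N, (-1 / 8 : ℂ) ^ m / m.factorial * (x i : ℂ) ^ m from
        Finset.sum_congr rfl fun m _ => by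
          rw [show (-x i / 8 : ℂ) = -1 / 8 * x i by ring, mul_pow]; ring]
    push_cast
    ring
  have hn : 2 * ‖(-x i / 8 : ℂ)‖ ≤ (∑ i, x i) / 4 := by
    have : ‖(-x i / 8 : ℂ)‖ = x i / 8 := by
      simp [abs_of_nonneg (hx i)]
    rw [this]
    linarith [Finset.single_le_sum (fun i _ => hx i) (Finset.mem_univ i)]
  rw [e, norm_mul]
  calc _ ≤ orthantWeight x ^ M * ((1 / 2) ^ N * Real.exp ((∑ i, x i) / 4) *
        ‖_root_.polyExp P x‖) := by
        gcongr
        exact (norm_exp_sub_sum_le_pow_mul_exp _ _).trans (by gcongr)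
    _ = (1 / 2) ^ N * (orthantWeight x ^ M *
          (‖_root_.polyExp P x‖ * Real.exp ((∑ i, x i) / 4))) := by ring
    _ ≤ ε / (C + 1) * C := by gcongr; exact h x hx
    _ ≤ ε := by
      rw [div_mul_eq_mul_div, div_le_iff₀ (by positivity)]
      nlinarith

lemma exp_mul (hu : IsPolyExpLimit u) (i : Fin d) :
    IsPolyExpLimit (fun x => (Real.exp (-x i / 8) : ℂ) * u x) :=
  of_approx fun M ε hε => by
  obtain ⟨P, hP⟩ := hu M ε hε
  refine ⟨_, exp_mul_polyExp P i, fun x hx => ?_⟩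
  have hw := one_le_orthantWeight hx
  rw [← mul_sub, norm_mul, Complex.norm_real, Real.norm_of_nonneg (Real.exp_pos _).le]
  refine le_trans ?_ (hP x hx)
  gcongr
  refine mul_le_of_le_one_left (norm_nonneg _) (Real.exp_le_one_iff.2 ?_)
  linarith [hx i]

end IsPolyExpLimit

namespace IsPolyExpLimit

variable {d : ℕ}

/-- The substitution `y i = e^{-x i / 8}`, with values in the unit cube. -/
def toCube (x : Fin d → ℝ) : Fin d → Set.Icc (0 : ℝ) 1 :=
  fun i => Set.projIcc 0 1 zero_le_one (Real.exp (-x i / 8))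

lemma toCube_apply {x : Fin d → ℝ} (hx : ∀ i, 0 ≤ x i) (i : Fin d) :
    (toCube x i : ℝ) = Real.exp (-x i / 8) := by
  rw [toCube, Set.projIcc_of_mem]
  refine ⟨(Real.exp_pos _).le, Real.exp_le_one_iff.2 ?_⟩
  linarith [hx i]

/-- The multipliers, as functions of `e^{-x/8}`, preserving `IsPolyExpLimit`. -/
def multipliers (d : ℕ) : Subalgebra ℝ C(Fin d → Set.Icc (0 : ℝ) 1, ℝ) where
  carrier := {φ | ∀ u : (Fin d → ℝ) → ℂ, IsPolyExpLimit u →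
    IsPolyExpLimit (fun x => (φ (toCube x) : ℂ) * u x)}
  mul_mem' := fun {φ ψ} hφ hψ u hu => (hφ _ (hψ u hu)).congr fun x _ => by
    simp [mul_assoc]
  add_mem' := fun {φ ψ} hφ hψ u hu => ((hφ u hu).add (hψ u hu)).congr fun x _ => by
    simp [add_mul]
  algebraMap_mem' := fun r u hu => (hu.const_mul r).congr fun x _ => by
    simp [Algebra.algebraMap_eq_smul_one]

lemma isClosed_multipliers : IsClosed (multipliers d : Set C(Fin d → Set.Icc (0 : ℝ) 1, ℝ)) := by
  refine isClosed_of_closure_subset fun φ hφ u hu => of_approx fun M ε hε => ?_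
  obtain ⟨C, hC, h⟩ := hu.exists_bound M
  obtain ⟨ψ, hψ, hd⟩ := Metric.mem_closure_iff.1 hφ (ε / (C + 1)) (by positivity)
  refine ⟨_, hψ u hu, fun x hx => ?_⟩
  have hw := one_le_orthantWeight hx
  have h1 : ‖φ (toCube x) - ψ (toCube x)‖ ≤ ε / (C + 1) := by
    rw [← dist_eq_norm]
    exact (ContinuousMap.dist_apply_le_dist _).trans hd.le
  rw [← sub_mul, norm_mul, ← Complex.ofReal_sub, Complex.norm_real]
  calc _ = ‖φ (toCube x) - ψ (toCube x)‖ * (orthantWeight x ^ M * ‖u x‖) := by ring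
    _ ≤ ε / (C + 1) * C := by gcongr; exact h x hx
    _ ≤ ε := by
      rw [div_mul_eq_mul_div, div_le_iff₀ (by positivity)]
      nlinarith

lemma multipliers_eq_top : multipliers d = ⊤ := by
  have hs : (multipliers d).SeparatesPoints := fun y z hyz => by
    obtain ⟨i, hi⟩ := Function.ne_iff.1 hyz
    let c : C(Fin d → Set.Icc (0 : ℝ) 1, ℝ) := ⟨fun y => (y i : ℝ), by fun_prop⟩
    refine ⟨c, ⟨c, fun u hu => (hu.exp_mul i).congr fun x hx => ?_, rfl⟩, ?_⟩
    · simp only [c, ContinuousMap.coe_mk, toCube_apply hx]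
    · exact fun h => hi (Subtype.ext h)
  have h := ContinuousMap.subalgebra_topologicalClosure_eq_top_of_separatesPoints _ hs
  rwa [SetLike.ext'_iff, Subalgebra.topologicalClosure_coe, isClosed_multipliers.closure_eq,
    ← SetLike.ext'_iff] at h

lemma continuous_mul (φ : (Fin d → Set.Icc (0 : ℝ) 1) → ℂ) (hφ : Continuous φ)
    {u : (Fin d → ℝ) → ℂ} (hu : IsPolyExpLimit u) :
    IsPolyExpLimit (fun x => φ (toCube x) * u x) := by
  have hmem (ψ : C(Fin d → Set.Icc (0 : ℝ) 1, ℝ)) : ψ ∈ multipliers d :=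
    multipliers_eq_top ▸ Algebra.mem_top
  have hre := hmem ⟨fun y => (φ y).re, by fun_prop⟩ u hu
  have him := hmem ⟨fun y => (φ y).im, by fun_prop⟩ u hu
  refine (hre.add (him.const_mul Complex.I)).congr fun x _ => ?_
  nth_rewrite 1 [← Complex.re_add_im (φ (toCube x))]
  simp only [ContinuousMap.coe_mk]
  ring

/-- A cutoff equal to `1` on `[0, R]` and to `0` on `[R + 1, ∞)`. -/
def cutoff (R t : ℝ) : ℝ := max 0 (min 1 (R + 1 - t))

/-- `-8 log`, truncated at `R + 1`. -/
def truncLog (R : ℝ) (y : Fin d → Set.Icc (0 : ℝ) 1) : Fin d → ℝ :=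
  fun i => -8 * Real.log (max (y i) (Real.exp (-(R + 1) / 8)))

lemma continuous_truncLog (R : ℝ) : Continuous (truncLog (d := d) R) := by
  refine continuous_pi fun i => continuous_const.mul (Continuous.log (by fun_prop) fun y => ?_)
  exact (lt_max_of_lt_right (Real.exp_pos _)).ne'

lemma truncLog_nonneg {R : ℝ} (hR : 0 ≤ R) (y : Fin d → Set.Icc (0 : ℝ) 1) (i : Fin d) :
    0 ≤ truncLog R y i := by
  have h : Real.log (max (y i) (Real.exp (-(R + 1) / 8))) ≤ 0 := by
    refine Real.log_nonpos (le_max_of_le_right (Real.exp_pos _).le) (max_le (y i).2.2 ?_)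
    exact Real.exp_le_one_iff.2 (by linarith)
  rw [truncLog]
  linarith

lemma truncLog_toCube (R : ℝ) {x : Fin d → ℝ} (hx : ∀ i, 0 ≤ x i) (i : Fin d) :
    truncLog R (toCube x) i = min (x i) (R + 1) := by
  rw [truncLog, toCube_apply hx]
  rcases le_total (x i) (R + 1) with h | h
  · rw [max_eq_left (Real.exp_le_exp.2 (by linarith)), Real.log_exp, min_eq_left h]; ring
  · rw [max_eq_right (Real.exp_le_exp.2 (by linarith)), Real.log_exp, min_eq_right h]; ring

lemma cutoff_mul {g : (Fin d → ℝ) → ℂ} (hg : ContinuousOn g {x | ∀ i, 0 ≤ x i}) {R : ℝ}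
    (hR : 0 ≤ R) : IsPolyExpLimit (fun x => ((∏ i, cutoff R (x i) : ℝ) : ℂ) * g x) := by
  let φ : (Fin d → Set.Icc (0 : ℝ) 1) → ℂ := fun y =>
    ((∏ i, cutoff R (truncLog R y i) : ℝ) : ℂ) * g (truncLog R y) *
      (Real.exp ((∑ i, truncLog R y i) / 2) : ℂ)
  have hT := continuous_truncLog (d := d) R
  have hφ : Continuous φ := by
    refine (Continuous.mul ?_ (hg.comp_continuous hT fun y => truncLog_nonneg hR y)).mul ?_
    · unfold cutoff
      fun_prop
    · fun_prop
  refine (continuous_mul φ hφ (polyExp 1)).congr fun x hx => ?_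
  by_cases hxR : ∀ i, x i ≤ R + 1
  · have : truncLog R (toCube x) = x := funext fun i => by
      rw [truncLog_toCube R hx, min_eq_left (hxR i)]
    simp only [φ, this, _root_.polyExp, map_one, one_mul]
    rw [mul_assoc _ (Complex.ofReal _), ← Complex.ofReal_mul, ← Real.exp_add]
    simp [← add_div]
  · push Not at hxR
    obtain ⟨i, hi⟩ := hxR
    have h0 {y : Fin d → ℝ} (hy : R + 1 ≤ y i) : ∏ i, cutoff R (y i) = 0 :=
      Finset.prod_eq_zero (Finset.mem_univ i)
        (max_eq_left (min_le_of_right_le (by linarith)))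
    simp only [φ]
    rw [h0 hi.le, h0 (by rw [truncLog_toCube R hx, min_eq_right hi.le])]
    simp

lemma of_rapidly_decreasing {g : (Fin d → ℝ) → ℂ} (hg : ContinuousOn g {x | ∀ i, 0 ≤ x i})
    (hb : ∀ M : ℕ, ∃ C : ℝ, ∀ x : Fin d → ℝ, (∀ i, 0 ≤ x i) → orthantWeight x ^ M * ‖g x‖ ≤ C) :
    IsPolyExpLimit g := of_approx fun M ε hε => by
  obtain ⟨C, h⟩ := hb (M + 1)
  have hC : 0 ≤ C := by
    refine le_trans ?_ (h 0 fun _ => le_rfl)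
    have := one_le_orthantWeight (d := d) (x := 0) fun _ => le_rfl
    positivity
  refine ⟨_, cutoff_mul hg (R := C / ε) (by positivity), fun x hx => ?_⟩
  have hw := one_le_orthantWeight hx
  have hc (i : Fin d) : 0 ≤ cutoff (C / ε) (x i) := le_max_left _ _
  have hc1 (i : Fin d) : cutoff (C / ε) (x i) ≤ 1 := max_le zero_le_one (min_le_left _ _)
  by_cases hxR : ∀ i, x i ≤ C / ε
  · have : ∏ i, cutoff (C / ε) (x i) = 1 := Finset.prod_eq_one fun i _ => by
      rw [cutoff, min_eq_left (by linarith [hxR i]), max_eq_right zero_le_one]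
    rw [this]
    simpa using hε.le
  · push Not at hxR
    obtain ⟨i, hi⟩ := hxR
    have h1 : ‖g x - ((∏ i, cutoff (C / ε) (x i) : ℝ) : ℂ) * g x‖ ≤ ‖g x‖ := by
      rw [← one_sub_mul, norm_mul, ← Complex.ofReal_one, ← Complex.ofReal_sub, Complex.norm_real]
      refine mul_le_of_le_one_left (norm_nonneg _) ?_
      have := Finset.prod_nonneg (s := Finset.univ) fun i _ => hc i
      have := Finset.prod_le_one (s := Finset.univ) (fun i _ => hc i) fun i _ => hc1 i
      rw [Real.norm_eq_abs, abs_le]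
      constructor <;> linarith
    have h2 := h x hx
    have h3 : C < ε * orthantWeight x := by
      rw [div_lt_iff₀ hε] at hi
      nlinarith [le_orthantWeight hx i]
    have h4 : orthantWeight x * (orthantWeight x ^ M * ‖g x‖) ≤ orthantWeight x * ε := by
      rw [pow_succ] at h2
      linarith
    refine le_trans ?_ (le_of_mul_le_mul_left h4 (by positivity))
    gcongr

end IsPolyExpLimit

section PartialDerivatives

variable {d : ℕ} {u v : (Fin d → ℝ) → ℂ}

lemma isOpen_Rpos : IsOpen (Rpos d) := by
  simp only [Rpos, Set.ofPred_forall]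
  exact isOpen_iInter_of_finite fun i => isOpen_lt continuous_const (continuous_apply i)

lemma ContDiffOn.pd (hu : ContDiffOn ℝ (⊤ : ℕ∞) u (Rpos d)) (i : Fin d) :
    ContDiffOn ℝ (⊤ : ℕ∞) (pd i u) (Rpos d) :=
  (hu.fderiv_of_isOpen isOpen_Rpos (m := (⊤ : ℕ∞)) le_rfl).clm_apply contDiffOn_const

lemma ContDiffOn.foldr_pd (hu : ContDiffOn ℝ (⊤ : ℕ∞) u (Rpos d)) (L : List (Fin d)) :
    ContDiffOn ℝ (⊤ : ℕ∞) (L.foldr _root_.pd u) (Rpos d) := by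
  induction L with
  | nil => exact hu
  | cons i L ih => exact ih.pd i

lemma ContDiffOn.differentiableAt_Rpos (hu : ContDiffOn ℝ (⊤ : ℕ∞) u (Rpos d)) {x : Fin d → ℝ}
    (hx : x ∈ Rpos d) : DifferentiableAt ℝ u x :=
  (hu.contDiffAt (isOpen_Rpos.mem_nhds hx)).differentiableAt (by simp)

lemma Set.EqOn.pd (h : Set.EqOn u v (Rpos d)) (i : Fin d) :
    Set.EqOn (pd i u) (pd i v) (Rpos d) := fun x hx => by
  simp only [_root_.pd, (h.eventuallyEq_of_mem (isOpen_Rpos.mem_nhds hx)).fderiv_eq]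

lemma pd_comm (hu : ContDiffOn ℝ (⊤ : ℕ∞) u (Rpos d)) (i k : Fin d) :
    Set.EqOn (pd i (pd k u)) (pd k (pd i u)) (Rpos d) := fun x hx => by
  have hd : DifferentiableAt ℝ (fderiv ℝ u) x :=
    ((hu.fderiv_of_isOpen isOpen_Rpos (m := (⊤ : ℕ∞)) le_rfl).contDiffAt
      (isOpen_Rpos.mem_nhds hx)).differentiableAt (by simp)
  have h (i k : Fin d) : pd i (pd k u) x
      = fderiv ℝ (fderiv ℝ u) x (Pi.single i 1) (Pi.single k 1) := by
    change fderiv ℝ (fun y => fderiv ℝ u y (Pi.single k 1)) x (Pi.single i 1) = _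
    rw [fderiv_clm_apply hd (differentiableAt_const _)]
    simp
  rw [h, h]
  refine (hu.contDiffAt (isOpen_Rpos.mem_nhds hx)).isSymmSndFDerivAt ?_ _ _
  simp only [minSmoothness_of_isRCLikeNormedField]
  exact WithTop.coe_le_coe.2 le_top

lemma List.Perm.foldr_pd_eqOn {L L' : List (Fin d)} (h : L.Perm L')
    (hu : ContDiffOn ℝ (⊤ : ℕ∞) u (Rpos d)) :
    Set.EqOn (L.foldr pd u) (L'.foldr pd u) (Rpos d) := by
  induction h with
  | nil => exact fun _ _ => rfl
  | cons i _ ih => exact ih.pd i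
  | swap i k L => exact pd_comm (hu.foldr_pd L) k i
  | trans _ _ ih ih' => exact ih.trans ih'

lemma foldr_pd_sub (hu : ContDiffOn ℝ (⊤ : ℕ∞) u (Rpos d))
    (hv : ContDiffOn ℝ (⊤ : ℕ∞) v (Rpos d)) (L : List (Fin d)) :
    Set.EqOn (L.foldr pd (fun y => u y - v y))
      (fun y => L.foldr pd u y - L.foldr pd v y) (Rpos d) := by
  induction L with
  | nil => exact fun _ _ => rfl
  | cons i L ih =>
    refine (ih.pd i).trans fun x hx => ?_
    change fderiv ℝ _ x _ = fderiv ℝ _ x _ - fderiv ℝ _ x _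
    rw [fderiv_fun_sub ((hu.foldr_pd L).differentiableAt_Rpos hx)
      ((hv.foldr_pd L).differentiableAt_Rpos hx)]
    rfl

/-- The list of directions of the successive derivatives in `mderiv p`. -/
def derivDirections (p : Fin d → ℕ) : List (Fin d) :=
  (List.ofFn fun i => List.replicate (p i) i).flatten

lemma mderiv_eq_foldr (p : Fin d → ℕ) (u : (Fin d → ℝ) → ℂ) :
    mderiv p u = (derivDirections p).foldr pd u := by
  have hr (i : Fin d) (n : ℕ) (u : (Fin d → ℝ) → ℂ) :
      (pd i)^[n] u = (List.replicate n i).foldr pd u := by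
    induction n with
    | zero => rfl
    | succ n ih => rw [Function.iterate_succ_apply', ih]; rfl
  rw [mderiv, derivDirections, List.ofFn_eq_map, List.ofFn_eq_map]
  induction List.finRange d with
  | nil => rfl
  | cons i L ih =>
    rw [List.map_cons, List.map_cons, List.flatten_cons, List.foldr_append, List.foldr_cons,
      Function.comp_apply, ih, hr]

lemma count_derivDirections (p : Fin d → ℕ) (i : Fin d) :
    (derivDirections p).count i = p i := by
  rw [derivDirections, List.count_flatten, List.map_ofFn, List.sum_ofFn]
  simp [List.count_replicate]

lemma mderiv_update_succ (hu : ContDiffOn ℝ (⊤ : ℕ∞) u (Rpos d)) (p : Fin d → ℕ) (i : Fin d) :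
    Set.EqOn (mderiv (Function.update p i (p i + 1)) u) (pd i (mderiv p u)) (Rpos d) := by
  rw [mderiv_eq_foldr, mderiv_eq_foldr]
  refine List.Perm.foldr_pd_eqOn (L' := i :: derivDirections p) ?_ hu
  rw [List.perm_iff_count]
  intro k
  rw [List.count_cons, count_derivDirections, count_derivDirections]
  rcases eq_or_ne i k with rfl | h
  · simp
  · simp [h, h.symm]

lemma orthantWeight_mono {x y : Fin d → ℝ} (hx : ∀ i, 0 ≤ x i) (h : ∀ i, x i ≤ y i) :
    orthantWeight x ≤ orthantWeight y :=
  Finset.prod_le_prod (fun i _ => by linarith [hx i]) fun i _ => by linarith [h i]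

/-- A weighted bound on a partial derivative of a function vanishing at infinity gives one on the
function itself. -/
lemma orthantWeight_pow_mul_norm_le_of_pd (hu : ContDiffOn ℝ (⊤ : ℕ∞) u (Rpos d)) (i : Fin d)
    {M : ℕ} {ε : ℝ} (hε : 0 ≤ ε)
    (h : ∀ x ∈ Rpos d, orthantWeight x ^ (M + 2) * ‖pd i u x‖ ≤ ε)
    {C : ℝ} (hC : ∀ x ∈ Rpos d, x i * ‖u x‖ ≤ C) :
    ∀ x ∈ Rpos d, orthantWeight x ^ M * ‖u x‖ ≤ ε := fun x hx => by
  have hx0 : ∀ k, 0 ≤ x k := fun k => (hx k).le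
  have hw := one_le_orthantWeight hx0
  set w := orthantWeight x
  set c : ℝ → Fin d → ℝ := fun t => x + t • Pi.single i 1 with hc
  have hle (t : ℝ) (ht : 0 ≤ t) (k : Fin d) : x k ≤ c t k := by
    by_cases hk : k = i
    · subst hk; simp [hc, ht]
    · simp [hc, hk]
  have hci (t : ℝ) : c t i = x i + t := by simp [hc]
  have hcpos (t : ℝ) (ht : 0 ≤ t) : c t ∈ Rpos d := fun k => (hx k).trans_le (hle t ht k)
  have hder (t : ℝ) (ht : 0 ≤ t) : HasDerivAt (fun t => u (c t)) (pd i u (c t)) t := by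
    refine (hu.differentiableAt_Rpos (hcpos t ht)).hasFDerivAt.comp_hasDerivAt t ?_
    have := ((hasDerivAt_id t).smul_const (Pi.single i 1 : Fin d → ℝ)).const_add x
    rwa [one_smul] at this
  have hbound (t : ℝ) (ht : 0 ≤ t) : ‖pd i u (c t)‖ ≤ ε / w ^ M * (1 / (1 + t) ^ 2) := by
    have hw' : w ≤ orthantWeight (c t) := orthantWeight_mono hx0 (hle t ht)
    have hw0 : 0 ≤ orthantWeight (c t) := by linarith
    have ht' : 1 + t ≤ orthantWeight (c t) := by
      have := le_orthantWeight (fun k => (hcpos t ht k).le) i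
      rw [hci] at this
      linarith [hx0 i]
    rw [div_mul_div_comm, mul_one, le_div_iff₀ (by positivity), mul_comm]
    refine le_trans ?_ (h _ (hcpos t ht))
    rw [pow_add]
    gcongr
  have hdiff (T : ℝ) (hT : 0 ≤ T) : ‖u (c T) - u (c 0)‖ ≤ ε / w ^ M := by
    have hB (t : ℝ) (ht : 0 ≤ t) : HasDerivAt (fun t : ℝ => ε / w ^ M * (1 - (1 + t)⁻¹))
        (ε / w ^ M * (1 / (1 + t) ^ 2)) t := by
      have h1 : (1 + t) ≠ 0 := by positivity
      convert! ((((hasDerivAt_id t).const_add 1).inv h1).const_sub 1).const_mul (ε / w ^ M) using 1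
      simp; ring
    have := image_norm_le_of_norm_deriv_right_le_deriv_boundary' (a := 0) (b := T)
      (f := fun t => u (c t) - u (c 0)) (f' := fun t => pd i u (c t))
      (fun t ht => ((hder t ht.1).continuousAt.sub continuousAt_const).continuousWithinAt)
      (fun t ht => ((hder t ht.1).sub_const _).hasDerivWithinAt)
      (by simp) (fun t ht => (hB t ht.1).continuousAt.continuousWithinAt)
      (fun t ht => (hB t ht.1).hasDerivWithinAt) (fun t ht => hbound t ht.1)
      (Set.right_mem_Icc.2 hT)
    refine this.trans (mul_le_of_le_one_right (by positivity) ?_)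
    have : 0 ≤ (1 + T)⁻¹ := by positivity
    linarith
  have hmain : ‖u x‖ ≤ ε / w ^ M := by
    refine le_of_forall_pos_le_add fun η hη => ?_
    have hT : 0 ≤ |C| / η := by positivity
    have h1 := hdiff _ hT
    have h2 : ‖u (c (|C| / η))‖ ≤ η := by
      have h3 := hC _ (hcpos _ hT)
      rw [hci] at h3
      have hp : 0 < x i + |C| / η := by linarith [hx i]
      refine le_of_mul_le_mul_left (h3.trans ?_) hp
      rw [add_mul, div_mul_cancel₀ _ hη.ne']
      have := mul_pos (hx i) hη
      linarith [le_abs_self C]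
    have h0 : c 0 = x := by simp [hc]
    rw [h0] at h1
    have := norm_sub_le_norm_sub_add_norm_sub (u x) (u (c (|C| / η))) 0
    rw [sub_zero, sub_zero, norm_sub_rev] at this
    linarith
  rwa [le_div_iff₀ (by positivity), mul_comm] at hmain

lemma orthantWeight_pow_mul_norm_mderiv_le (hu : ContDiffOn ℝ (⊤ : ℕ∞) u (Rpos d))
    (hdecay : ∀ (p : Fin d → ℕ) (i : Fin d), ∃ C : ℝ, ∀ x ∈ Rpos d, x i * ‖mderiv p u x‖ ≤ C)
    {j : ℕ} {ε : ℝ} (hε : 0 ≤ ε) (n : ℕ) : ∀ (M : ℕ) (p : Fin d → ℕ), (∀ i, p i ≤ j) →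
      ∑ i, (j - p i) = n →
      (∀ x ∈ Rpos d, orthantWeight x ^ (M + 2 * n) * ‖mderiv (fun _ => j) u x‖ ≤ ε) →
      ∀ x ∈ Rpos d, orthantWeight x ^ M * ‖mderiv p u x‖ ≤ ε := by
  induction n with
  | zero =>
    intro M p hp hs h
    have : p = fun _ => j := funext fun i => by
      have := Finset.sum_eq_zero_iff.1 hs i (Finset.mem_univ i)
      have := hp i
      omega
    simpa [this] using h
  | succ n ih =>
    intro M p hp hs h
    obtain ⟨i, -, hi⟩ : ∃ i ∈ Finset.univ, j - p i ≠ 0 :=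
      Finset.exists_ne_zero_of_sum_ne_zero (by omega)
    obtain ⟨C, hC⟩ := hdecay p i
    refine orthantWeight_pow_mul_norm_le_of_pd (i := i) ?_ hε (fun x hx => ?_) hC
    · rw [mderiv_eq_foldr]
      exact hu.foldr_pd _
    · rw [← mderiv_update_succ hu p i hx]
      refine ih (M + 2) _ (fun k => ?_) ?_ (fun x hx => ?_) x hx
      · rcases eq_or_ne k i with rfl | hk
        · simp; omega
        · simpa [hk] using hp k
      · rw [← Finset.add_sum_erase _ _ (Finset.mem_univ i)] at hs ⊢
        rw [Finset.sum_congr rfl fun k hk => by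
          rw [Function.update_of_ne (Finset.ne_of_mem_erase hk)]]
        rw [Function.update_self]
        omega
      · rw [show M + 2 + 2 * n = M + 2 * (n + 1) by ring]
        exact h x hx

end PartialDerivatives

section PolyExpDerivatives

variable {d : ℕ}

lemma contDiff_eval_ofReal (P : MvPolynomial (Fin d) ℂ) :
    ContDiff ℝ (⊤ : ℕ∞) (fun x : Fin d → ℝ => MvPolynomial.eval (fun i => (x i : ℂ)) P) := by
  induction P using MvPolynomial.induction_on with
  | C a => simpa using contDiff_const
  | add P Q hP hQ => simpa using hP.add hQ
  | mul_X P i hP =>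
    simpa using hP.mul (Complex.ofRealCLM.contDiff.comp (contDiff_apply ℝ ℝ i))

lemma contDiff_polyExp (P : MvPolynomial (Fin d) ℂ) : ContDiff ℝ (⊤ : ℕ∞) (polyExp P) := by
  have he : ContDiff ℝ (⊤ : ℕ∞) fun x : Fin d → ℝ => Real.exp (-(∑ i, x i) / 2) := by fun_prop
  exact (contDiff_eval_ofReal P).mul (Complex.ofRealCLM.contDiff.comp he)

lemma pd_eval_ofReal (i : Fin d) (P : MvPolynomial (Fin d) ℂ) (x : Fin d → ℝ) :
    pd i (fun x => MvPolynomial.eval (fun i => (x i : ℂ)) P) x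
      = MvPolynomial.eval (fun i => (x i : ℂ)) (MvPolynomial.pderiv i P) := by
  have hd (P : MvPolynomial (Fin d) ℂ) : DifferentiableAt ℝ
      (fun x : Fin d → ℝ => MvPolynomial.eval (fun i => (x i : ℂ)) P) x :=
    (contDiff_eval_ofReal P).contDiffAt.differentiableAt (by simp)
  induction P using MvPolynomial.induction_on with
  | C a => simp [pd]
  | add P Q hP hQ =>
    simp only [pd, map_add] at *
    rw [fderiv_fun_add (hd P) (hd Q), ← hP, ← hQ]
    rfl
  | mul_X P k hP =>
    have hX : HasFDerivAt (fun x : Fin d → ℝ => (x k : ℂ))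
        (Complex.ofRealCLM.comp (ContinuousLinearMap.proj k)) x :=
      (Complex.ofRealCLM.comp (ContinuousLinearMap.proj k : (Fin d → ℝ) →L[ℝ] ℝ)).hasFDerivAt
    have := ((hd P).hasFDerivAt.mul hX).fderiv
    simp only [pd, map_mul, MvPolynomial.eval_X] at *
    rw [show (fun x : Fin d → ℝ => MvPolynomial.eval (fun i => (x i : ℂ)) P * (x k : ℂ))
      = (fun x : Fin d → ℝ => MvPolynomial.eval (fun i => (x i : ℂ)) P) * fun x => (x k : ℂ)
      from rfl, this]
    rcases eq_or_ne k i with rfl | h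
    · simp [hP]
    · simp [hP, MvPolynomial.pderiv_X_of_ne h, h]

/-- The action of `∂ / ∂x i` on `polyExp`, read on polynomials. -/
def polyExpDeriv (i : Fin d) (P : MvPolynomial (Fin d) ℂ) : MvPolynomial (Fin d) ℂ :=
  MvPolynomial.pderiv i P - MvPolynomial.C (1 / 2) * P

lemma pd_polyExp (i : Fin d) (P : MvPolynomial (Fin d) ℂ) :
    pd i (polyExp P) = polyExp (polyExpDeriv i P) := by
  funext x
  have hs : HasFDerivAt (fun x : Fin d → ℝ => -(∑ k, x k) / 2)
      ((-(1 / 2) : ℝ) • ∑ k, (ContinuousLinearMap.proj k : (Fin d → ℝ) →L[ℝ] ℝ)) x := by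
    convert! ((-(1 / 2) : ℝ) •
      ∑ k, (ContinuousLinearMap.proj k : (Fin d → ℝ) →L[ℝ] ℝ)).hasFDerivAt using 1
    funext y
    simp
    ring
  have he : HasFDerivAt (fun x : Fin d → ℝ => (Real.exp (-(∑ k, x k) / 2) : ℂ)) _ x :=
    Complex.ofRealCLM.hasFDerivAt.comp x hs.exp
  have hP := ((contDiff_eval_ofReal P).contDiffAt (x := x)).differentiableAt (by simp)
  have hmul := (hP.hasFDerivAt.mul he).fderiv
  have h := pd_eval_ofReal i P x
  unfold pd at h ⊢
  rw [show polyExp P = (fun x : Fin d → ℝ => MvPolynomial.eval (fun i => (x i : ℂ)) P) *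
    fun x => (Real.exp (-(∑ k, x k) / 2) : ℂ) from rfl, hmul]
  simp [h, polyExp, polyExpDeriv]
  ring

lemma foldr_pd_polyExp (L : List (Fin d)) (P : MvPolynomial (Fin d) ℂ) :
    L.foldr pd (polyExp P) = polyExp (L.foldr polyExpDeriv P) := by
  induction L with
  | nil => rfl
  | cons i L ih => rw [List.foldr_cons, ih, pd_polyExp, List.foldr_cons]

lemma surjective_polyExpDeriv (i : Fin d) : Function.Surjective (polyExpDeriv i) := by
  have hadd (P Q : MvPolynomial (Fin d) ℂ) :
      polyExpDeriv i (P + Q) = polyExpDeriv i P + polyExpDeriv i Q := by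
    simp only [polyExpDeriv, map_add]; ring
  have hmon (n : ℕ) : ∀ (s : Fin d →₀ ℕ) (a : ℂ), s i = n →
      ∃ P, polyExpDeriv i P = MvPolynomial.monomial s a := by
    induction n with
    | zero =>
      intro s a hs
      refine ⟨MvPolynomial.C (-2) * MvPolynomial.monomial s a, ?_⟩
      rw [polyExpDeriv, ← mul_assoc, ← MvPolynomial.C_mul, MvPolynomial.C_mul_monomial,
        MvPolynomial.C_mul_monomial, MvPolynomial.pderiv_monomial, hs]
      norm_num
    | succ n ih =>
      intro s a hs
      obtain ⟨P, hP⟩ := ih (s - Finsupp.single i 1) (2 * a * s i) (by simp [hs])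
      refine ⟨MvPolynomial.monomial s (-2 * a) + P, ?_⟩
      rw [hadd, hP, polyExpDeriv, MvPolynomial.pderiv_monomial, MvPolynomial.C_mul_monomial,
        sub_add_eq_add_sub, ← map_add]
      rw [show -2 * a * (s i : ℂ) + 2 * a * s i = 0 by ring, map_zero, zero_sub, ← map_neg]
      congr 1
      ring
  intro Q
  induction Q using MvPolynomial.induction_on' with
  | monomial s a => exact hmon _ s a rfl
  | add P Q hP hQ =>
    obtain ⟨P', rfl⟩ := hP
    obtain ⟨Q', rfl⟩ := hQ
    exact ⟨P' + Q', hadd _ _⟩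

lemma surjective_foldr_polyExpDeriv (L : List (Fin d)) :
    Function.Surjective (L.foldr (polyExpDeriv (d := d))) := by
  induction L with
  | nil => exact fun P => ⟨P, rfl⟩
  | cons i L ih => exact (surjective_polyExpDeriv i).comp ih

lemma exists_mul_norm_polyExp_le (P : MvPolynomial (Fin d) ℂ) (i : Fin d) :
    ∃ C : ℝ, ∀ x ∈ Rpos d, x i * ‖polyExp P x‖ ≤ C := by
  obtain ⟨C, -, h⟩ := (IsPolyExpLimit.polyExp P).exists_bound 1
  refine ⟨C, fun x hx => le_trans ?_ (h x fun i => (hx i).le)⟩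
  rw [pow_one]
  gcongr
  linarith [le_orthantWeight (fun i => (hx i).le) i]

end PolyExpDerivatives

section LaguerreSpan

lemma pow_mul_exp_mem_span_lagFun {γ : ℝ} (hγ : 0 ≤ γ) (k : ℕ) :
    (fun t : ℝ => t ^ k * Real.exp (-t / 2)) ∈ Submodule.span ℝ (Set.range (lagFun γ)) := by
  induction k using Nat.strong_induction_on with
  | _ k ih =>
    have hΓ (n : ℕ) : 0 < Real.Gamma (n + γ + 1) := Real.Gamma_pos_of_pos (by positivity)
    set s := Real.sqrt (k.factorial / Real.Gamma (k + γ + 1)) with hs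
    have hs0 : 0 < s := Real.sqrt_pos.2 (div_pos (by positivity) (hΓ k))
    set c : ℕ → ℝ := fun m => s * (Real.Gamma (k + γ + 1) /
      (Real.Gamma (m + γ + 1) * (k - m).factorial * m.factorial) * (-1) ^ m) with hc
    have hck : c k ≠ 0 := by
      have := (hΓ k).ne'
      have : (-1 : ℝ) ^ k ≠ 0 := pow_ne_zero _ (by norm_num)
      simp only [hc]
      positivity
    have hexp : lagFun γ k = ∑ m ∈ range (k + 1), c m • fun t : ℝ => t ^ m * Real.exp (-t / 2) := by
      funext t
      rw [lagFun, lagP, Finset.sum_apply, Finset.mul_sum, Finset.sum_mul]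
      refine Finset.sum_congr rfl fun m _ => ?_
      simp only [Pi.smul_apply, smul_eq_mul, hc, ← hs]
      rw [neg_pow t]
      ring
    rw [Finset.sum_range_succ, ← sub_eq_iff_eq_add'] at hexp
    have := Submodule.smul_mem _ (c k)⁻¹ (hexp ▸ Submodule.sub_mem _
      (Submodule.subset_span (Set.mem_range_self k))
      (Submodule.sum_mem _ fun m hm => Submodule.smul_mem _ (c m) (ih m (Finset.mem_range.1 hm))))
    rwa [smul_smul, inv_mul_cancel₀ hck, one_smul] at this

variable {d : ℕ} {γ : Fin d → ℝ}

lemma polyExp_mem_span_LagFun (hγ : ∀ l, 0 ≤ γ l) (P : MvPolynomial (Fin d) ℂ) :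
    polyExp P ∈ Submodule.span ℂ (Set.range fun (m : Fin d → ℕ) (y : Fin d → ℝ) =>
      (LagFun γ m y : ℂ)) := by
  induction P using MvPolynomial.induction_on' with
  | monomial s a =>
    choose c hc using fun l => Finsupp.mem_span_range_iff_exists_finsupp.1
      (pow_mul_exp_mem_span_lagFun (hγ l) (s l))
    have h : polyExp (MvPolynomial.monomial s a) = ∑ m ∈ Fintype.piFinset fun l => (c l).support,
        (a * ((∏ l, c l (m l) : ℝ) : ℂ)) • fun y => (LagFun γ m y : ℂ) := by
      funext y
      have hl (l : Fin d) : y l ^ s l * Real.exp (-y l / 2)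
          = ∑ m ∈ (c l).support, c l m * lagFun (γ l) m (y l) := by
        have := congrFun (hc l) (y l)
        simpa [Finsupp.sum] using this.symm
      have hprod : (∏ l, y l ^ s l) * Real.exp (-(∑ l, y l) / 2)
          = ∑ m ∈ Fintype.piFinset fun l => (c l).support, (∏ l, c l (m l)) * LagFun γ m y := by
        rw [← Finset.sum_neg_distrib, Finset.sum_div, Real.exp_sum, ← Finset.prod_mul_distrib,
          Finset.prod_congr rfl fun l _ => hl l, Finset.prod_univ_sum]
        exact Finset.sum_congr rfl fun m _ => Finset.prod_mul_distrib
      have := congrArg (fun r : ℝ => a * (r : ℂ)) hprod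
      simp only [Complex.ofReal_sum, Finset.mul_sum] at this
      rw [Finset.sum_apply]
      convert this using 1
      · rw [polyExp, MvPolynomial.eval_monomial, Finsupp.prod_fintype _ _ (by simp)]
        push_cast
        ring
      · refine Finset.sum_congr rfl fun m _ => ?_
        simp only [Pi.smul_apply, smul_eq_mul]
        push_cast
        ring
    rw [h]
    exact Submodule.sum_mem _ fun m _ =>
      Submodule.smul_mem _ _ (Submodule.subset_span (Set.mem_range_self m))
  | add P Q hP hQ =>
    convert Submodule.add_mem _ hP hQ using 1
    funext x
    simp only [polyExp, map_add, Pi.add_apply]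
    ring

lemma exists_sum_LagFun_eq_polyExp (hγ : ∀ l, 0 ≤ γ l) (P : MvPolynomial (Fin d) ℂ) :
    ∃ (n : Fin d → ℕ) (a : (Fin d → ℕ) → ℂ), ∀ y : Fin d → ℝ,
      ∑ m : (∀ i, Fin (n i + 1)), a (fun i => (m i : ℕ)) *
        ((LagFun γ (fun i => (m i : ℕ)) y : ℝ) : ℂ) = polyExp P y := by
  obtain ⟨c, hc⟩ := Finsupp.mem_span_range_iff_exists_finsupp.1 (polyExp_mem_span_LagFun hγ P)
  refine ⟨fun i => c.support.sup fun m => m i, c, fun y => ?_⟩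
  rw [← hc, Finsupp.sum, Finset.sum_apply]
  have hbox : c.support ⊆ Fintype.piFinset fun i => range ((c.support.sup fun m => m i) + 1) :=
    fun m hm => Fintype.mem_piFinset.2 fun i => Finset.mem_range_succ_iff.2
      (Finset.le_sup (f := fun m : Fin d → ℕ => m i) hm)
  rw [Finset.sum_subset hbox fun m _ hm => by simp [Finsupp.notMem_support_iff.1 hm]]
  refine Finset.sum_of_injOn
    (fun (m : ∀ i, Fin ((c.support.sup fun m => m i) + 1)) i => (m i : ℕ))
    (fun m _ m' _ h => funext fun i => Fin.ext (congrFun h i))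
    (fun m _ => Finset.mem_coe.2 <| Fintype.mem_piFinset.2 fun i => Finset.mem_range.2 (m i).2)
    (fun m hm hm' => ?_) fun m _ => rfl
  exact absurd ⟨fun i => ⟨m i, Finset.mem_range.1 (Fintype.mem_piFinset.1 hm i)⟩,
    Finset.mem_coe.2 (Finset.mem_univ _), rfl⟩ hm'

end LaguerreSpan

section SeminormComparison

variable {d : ℕ}

lemma prod_pow_le_orthantWeight_pow {x : Fin d → ℝ} (hx : ∀ i, 0 ≤ x i) {k : Fin d → ℕ} {j : ℕ}
    (hk : ∀ i, k i ≤ j) : ∏ i, x i ^ k i ≤ orthantWeight x ^ j := by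
  rw [orthantWeight, ← Finset.prod_pow]
  refine Finset.prod_le_prod (fun i _ => pow_nonneg (hx i) _) fun i _ => ?_
  calc x i ^ k i ≤ (1 + x i) ^ k i := pow_le_pow_left₀ (hx i) (by linarith) _
    _ ≤ (1 + x i) ^ j := pow_le_pow_right₀ (by linarith [hx i]) (hk i)

lemma orthantWeight_pow_eq (x : Fin d → ℝ) (M : ℕ) : orthantWeight x ^ M =
    ∑ k ∈ Fintype.piFinset fun _ : Fin d => range (M + 1),
      (∏ i, (M.choose (k i) : ℝ)) * ∏ i, x i ^ k i := by
  rw [orthantWeight, ← Finset.prod_pow]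
  simp_rw [add_comm (1 : ℝ), add_pow, one_pow, mul_one]
  rw [Finset.prod_univ_sum]
  exact Finset.sum_congr rfl fun k _ => by rw [Finset.prod_mul_distrib, mul_comm]

lemma nonneg_subset_closure_Rpos : {x : Fin d → ℝ | ∀ i, 0 ≤ x i} ⊆ closure (Rpos d) := by
  intro x hx
  have hlim : Tendsto (fun (t : ℝ) i => x i + t) (nhdsWithin 0 (Set.Ioi 0)) (nhds x) := by
    have : Tendsto (fun (t : ℝ) i => x i + t) (nhds 0) (nhds fun i => x i + 0) :=
      (by fun_prop : Continuous fun (t : ℝ) i => x i + t).tendsto 0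
    simpa using this.mono_left nhdsWithin_le_nhds
  refine mem_closure_of_tendsto hlim ?_
  filter_upwards [self_mem_nhdsWithin] with t ht i
  exact add_pos_of_nonneg_of_pos (hx i) ht

lemma exists_orthantWeight_bound {g : (Fin d → ℝ) → ℂ}
    (hg : ContinuousOn g {x | ∀ i, 0 ≤ x i})
    (hb : ∀ k : Fin d → ℕ, ∃ C : ℝ, ∀ x ∈ Rpos d, (∏ i, x i ^ k i) * ‖g x‖ ≤ C) (M : ℕ) :
    ∃ C : ℝ, ∀ x : Fin d → ℝ, (∀ i, 0 ≤ x i) → orthantWeight x ^ M * ‖g x‖ ≤ C := by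
  choose C hC using hb
  refine ⟨∑ k ∈ Fintype.piFinset fun _ : Fin d => range (M + 1),
    (∏ i, (M.choose (k i) : ℝ)) * C k, fun x hx => ?_⟩
  have hpos (y : Fin d → ℝ) (hy : y ∈ Rpos d) : orthantWeight y ^ M * ‖g y‖ ≤
      ∑ k ∈ Fintype.piFinset fun _ : Fin d => range (M + 1),
        (∏ i, (M.choose (k i) : ℝ)) * C k := by
    rw [orthantWeight_pow_eq, Finset.sum_mul]
    refine Finset.sum_le_sum fun k _ => ?_
    rw [mul_assoc]
    gcongr
    exact hC k y hy
  have hsub : Rpos d ⊆ {x : Fin d → ℝ | ∀ i, 0 ≤ x i} := fun y hy i => (hy i).le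
  have hcont : ContinuousWithinAt (fun y => orthantWeight y ^ M * ‖g y‖) (Rpos d) x := by
    refine ContinuousWithinAt.mul ?_ ((hg x hx).mono hsub).norm
    have : Continuous fun y : Fin d → ℝ => ∏ i, (1 + y i) :=
      continuous_finsetProd _ fun i _ => by fun_prop
    exact (this.pow M).continuousWithinAt
  have : (nhdsWithin x (Rpos d)).NeBot := mem_closure_iff_nhdsWithin_neBot.1 (nonneg_subset_closure_Rpos hx)
  exact le_of_tendsto hcont (eventually_nhdsWithin_of_forall hpos)

end SeminormComparison

/-- Density of the span of the Laguerre functions `{𝓛_n^γ}` in `S(ℝ^d₊)`: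
for every `f ∈ S(ℝ^d₊)`, `j` and `ε > 0` there is a finite linear combination
`g = ∑_{k ≤ n} a_k 𝓛_k^γ` with `q_j(f − g) < ε`. -/
theorem stmt6 {d : ℕ} (γ : Fin d → ℝ) (hγ : ∀ l, 0 ≤ γ l) (f : (Fin d → ℝ) → ℂ)
    (hf : IsSPlus f) (j : ℕ) (ε : ℝ) (hε : 0 < ε) :
    ∃ (n : Fin d → ℕ) (a : (Fin d → ℕ) → ℂ) (δ : ℝ), δ < ε ∧
      ∀ p k : Fin d → ℕ, (∑ i, p i) ≤ j → (∑ i, k i) ≤ j → ∀ x ∈ Rpos d,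
        (∏ i, x i ^ k i) *
          ‖mderiv p (fun y => f y -
              ∑ m : (∀ i, Fin (n i + 1)),
                a (fun i => (m i : ℕ)) * ((LagFun γ (fun i => (m i : ℕ)) y : ℝ) : ℂ)) x‖
          ≤ δ := by
  obtain ⟨hsm, hext, hrd⟩ := hf
  set J : Fin d → ℕ := fun _ => j
  set M := j + 2 * ∑ _i : Fin d, j
  obtain ⟨g, hgc, hg⟩ := hext J
  obtain ⟨Q, hQ⟩ := IsPolyExpLimit.of_rapidly_decreasing hgc
    (exists_orthantWeight_bound hgc fun k => by
      obtain ⟨C, hC⟩ := hrd k J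
      exact ⟨C, fun x hx => by rw [hg x hx]; exact hC x hx⟩) M (ε / 2) (half_pos hε)
  obtain ⟨P, hP⟩ := surjective_foldr_polyExpDeriv (derivDirections J) Q
  obtain ⟨n, a, hna⟩ := exists_sum_LagFun_eq_polyExp hγ P
  refine ⟨n, a, ε / 2, half_lt_self hε, fun p k hp hk x hx => ?_⟩
  simp only [hna]
  have hPs : ContDiffOn ℝ (⊤ : ℕ∞) (polyExp P) (Rpos d) := (contDiff_polyExp P).contDiffOn
  have hsub (p : Fin d → ℕ) (x : Fin d → ℝ) (hx : x ∈ Rpos d) :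
      mderiv p (fun y => f y - polyExp P y) x
        = mderiv p f x - polyExp ((derivDirections p).foldr polyExpDeriv P) x := by
    rw [mderiv_eq_foldr, foldr_pd_sub hsm hPs _ hx, foldr_pd_polyExp, mderiv_eq_foldr]
  have hle {v : Fin d → ℕ} (hv : ∑ i, v i ≤ j) (i : Fin d) : v i ≤ j :=
    (Finset.single_le_sum (fun _ _ => Nat.zero_le _) (Finset.mem_univ i)).trans hv
  have hw := one_le_orthantWeight fun i => (hx i).le
  have hmain := orthantWeight_pow_mul_norm_mderiv_le (hsm.sub hPs) (j := j) (ε := ε / 2)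
    (fun p i => ?_) (half_pos hε).le (∑ i, (j - p i)) j p (hle hp) rfl (fun x hx => ?_) x hx
  · refine le_trans ?_ hmain
    gcongr
    exact prod_pow_le_orthantWeight_pow (fun i => (hx i).le) (hle hk)
  · obtain ⟨C, hC⟩ := hrd (Pi.single i 1) p
    obtain ⟨C', hC'⟩ := exists_mul_norm_polyExp_le ((derivDirections p).foldr polyExpDeriv P) i
    refine ⟨C + C', fun x hx => ?_⟩
    have h := hC x hx
    rw [Finset.prod_eq_single i (fun k _ hk => by simp [hk]) (by simp), Pi.single_eq_same,
      pow_one] at h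
    have hxi := hx i
    calc _ ≤ x i * (‖mderiv p f x‖ + ‖polyExp ((derivDirections p).foldr polyExpDeriv P) x‖) := by
          rw [hsub p x hx]
          gcongr
          exact norm_sub_le _ _
      _ ≤ C + C' := by rw [mul_add]; exact add_le_add h (hC' x hx)
  · have hw := one_le_orthantWeight fun i => (hx i).le
    have h := hQ x fun i => (hx i).le
    rw [hg x hx, ← hP, ← hsub J x hx] at h
    refine le_trans ?_ h
    refine mul_le_mul_of_nonneg_right (pow_le_pow_right₀ hw ?_) (norm_nonneg _)
    have := Finset.sum_le_sum (s := Finset.univ) fun i _ => Nat.sub_le j (p i)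
    omega
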